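/- For all integers a ≥ 1 and k, ℓ ≥ 0 and every composition β, the following identity holds in ℤ[q,t]: Cat^Rise_{(a+1,β),k,ℓ}(q,t) = t^a q^{ℓ(β)} Σ_{γ ⊨ a} Cat^Rise_{(β,γ),k,ℓ}(q,t) + t^a q^{ℓ(β)} Σ_{γ ⊨ a+1} Cat^Rise_{(β,γ),k,ℓ−1}(q,t), where (a+1,β) denotes the composition with first part a+1 followed by the parts of β. -/

import Mathlib

open Finset

namespace DeltaCat

/-- `i`-th entry (0-indexed) of an area sequence, defaulting to `0`. -/
def ent (l : List ℕ) (i : ℕ) : ℕ := l.getD i 0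

/-- `l` is the area sequence of a Dyck path (of size `l.length ≥ 1`): it is nonempty,
starts with `0`, and consecutive entries increase by at most one. -/
def IsDyck (l : List ℕ) : Prop :=
  l ≠ [] ∧ ent l 0 = 0 ∧ ∀ i < l.length, i + 1 < l.length → ent l (i + 1) ≤ ent l i + 1

instance (l : List ℕ) : Decidable (IsDyck l) := by unfold IsDyck; infer_instance

/-- the area of a Dyck path -/
def area (l : List ℕ) : ℕ := l.sum

/-- the diagonal inversions of a Dyck path: pairs `(i,j)`, `i < j`, with
`a_i = a_j` or `a_i = a_j + 1` (0-indexed rows). -/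
def dinvPairs (l : List ℕ) : Finset (ℕ × ℕ) :=
  (Finset.range l.length ×ˢ Finset.range l.length).filter
    (fun p => p.1 < p.2 ∧ (ent l p.1 = ent l p.2 ∨ ent l p.1 = ent l p.2 + 1))

/-- the number of diagonal inversions -/
def dinv (l : List ℕ) : ℕ := (dinvPairs l).card

/-- `b'(k) = #{j > k : a_j = a_k} + #{j < k : a_j = a_k + 1}` (0-indexed rows). -/
def bval (l : List ℕ) (k : ℕ) : ℕ :=
  ((Finset.range l.length).filter (fun j => k < j ∧ ent l j = ent l k)).card +
  ((Finset.range l.length).filter (fun j => j < k ∧ ent l j = ent l k + 1)).card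

/-- row `i` (0-indexed) is a double rise -/
def IsRise (l : List ℕ) (i : ℕ) : Prop := i + 1 < l.length ∧ ent l (i + 1) = ent l i + 1

instance (l : List ℕ) (i : ℕ) : Decidable (IsRise l i) := by unfold IsRise; infer_instance

/-- row `i` (0-indexed) is a peak -/
def IsPeak (l : List ℕ) (i : ℕ) : Prop := i < l.length ∧ ¬ IsRise l i

instance (l : List ℕ) (i : ℕ) : Decidable (IsPeak l i) := by unfold IsPeak; infer_instance

/-- `Rise_∘(D,S)`: the decorated rows which are double rises -/
def riseSet (l : List ℕ) (S : Finset ℕ) : Finset ℕ := S.filter (fun i => IsRise l i)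

/-- `Peak_∘(D,S)`: the decorated rows which are peaks -/
def peakSet (l : List ℕ) (S : Finset ℕ) : Finset ℕ := S.filter (fun i => IsPeak l i)

/-- `area_∘(D,S)` -/
def areaC (l : List ℕ) (S : Finset ℕ) : ℕ := area l - ∑ i ∈ riseSet l S, ent l (i + 1)

/-- `dinv_∘(D,S)` -/
def dinvC (l : List ℕ) (S : Finset ℕ) : ℕ := dinv l - ∑ i ∈ peakSet l S, bval l i

/-- the largest row index (0-indexed) attaining the maximal area value -/
def lastMaxRow (l : List ℕ) : ℕ :=
  ((Finset.range l.length).filter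
    (fun i => ∀ j ∈ Finset.range l.length, ent l j ≤ ent l i)).sup id

/-- `S` is a valid set of ∘-decorations on the rows of `l` : a set of rows not containing
the largest index attaining the maximal area value. -/
def ValidDec (l : List ℕ) (S : Finset ℕ) : Prop :=
  (∀ i ∈ S, i < l.length) ∧ lastMaxRow l ∉ S

instance (l : List ℕ) (S : Finset ℕ) : Decidable (ValidDec l S) := by
  unfold ValidDec; infer_instance

/-- the (0-indexed) rows where the path touches the diagonal, i.e. the starts of segments -/
def segStarts (l : List ℕ) : List ℕ :=
  (List.range l.length).filter (fun i => ent l i == 0)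

/-- the touch composition of a Dyck path: the list of lengths of the maximal segments -/
def touchComp (l : List ℕ) : List ℕ :=
  List.zipWith (fun cur next => next - cur) (segStarts l) ((segStarts l).drop 1 ++ [l.length])

/-- the rise-touch composition `α^Rise(D,S)`: the touch composition with the number of
decorated double rises in each segment subtracted from the corresponding part. -/
def riseTouch (l : List ℕ) (S : Finset ℕ) : List ℕ :=
  List.zipWith
    (fun cur next => (next - cur) - ((riseSet l S).filter (fun i => cur ≤ i ∧ i < next)).card)
    (segStarts l) ((segStarts l).drop 1 ++ [l.length])

/-- all lists of length `n` with entries at most `n`; this contains every Dyck path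
area sequence of size `n`. -/
def allSeqs (n : ℕ) : Finset (List ℕ) :=
  (Finset.univ : Finset (Fin n → Fin (n + 1))).image fun v => (List.ofFn v).map Fin.val

/-- the Finset of all Dyck paths of size `n` (encoded by their area sequences) -/
def dyckPaths (n : ℕ) : Finset (List ℕ) := (allSeqs n).filter IsDyck

/-- the Finset of all ∘-decorated Dyck paths of size `n` -/
def decPaths (n : ℕ) : Finset (List ℕ × Finset ℕ) :=
  ((allSeqs n) ×ˢ (Finset.range n).powerset).filter fun p => IsDyck p.1 ∧ ValidDec p.1 p.2

/-- `Cat^Rise_{α,k,ℓ}(q,t)`, the generating function of ∘-decorated Dyck paths of size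
`|α| + ℓ` with `k` decorated peaks, `ℓ` decorated double rises and rise-touch composition
`α`, by the statistics `dinv_∘` and `area_∘`; it is `0` when `k < 0` or `ℓ < 0`. -/
def CatRise {R : Type*} [CommRing R] (q t : R) (α : List ℕ) (k ℓ : ℤ) : R :=
  if 0 ≤ k ∧ 0 ≤ ℓ then
    ∑ p ∈ (decPaths (α.sum + ℓ.toNat)).filter
        (fun p => (peakSet p.1 p.2).card = k.toNat ∧ (riseSet p.1 p.2).card = ℓ.toNat ∧
          riseTouch p.1 p.2 = α),
      q ^ dinvC p.1 p.2 * t ^ areaC p.1 p.2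
  else 0

end DeltaCat

open DeltaCat

/-- the variable `q` of `ℤ[q,t]` -/
noncomputable def q : MvPolynomial (Fin 2) ℤ := MvPolynomial.X 0

/-- the variable `t` of `ℤ[q,t]` -/
noncomputable def t : MvPolynomial (Fin 2) ℤ := MvPolynomial.X 1

namespace DeltaCat

/-! ### Moving the first segment of a path to its end -/

/-- The area sequence obtained from `r ++ w` by moving the block `w` to the front, raising it by
one and inserting a first row `0`. -/
def raised (r w : List ℕ) : List ℕ := 0 :: (w.map (· + 1) ++ r)

/-- The row of `raised r w` corresponding to the row `i` of `r ++ w`, where `m` and `n` are the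
lengths of `r` and `w`; it is extended to an injection of `ℕ` with image the positive integers. -/
def shiftRow (m n i : ℕ) : ℕ :=
  if i < m then i + n + 1 else if i < m + n then i - m + 1 else i + 1

theorem shiftRow_injective (m n : ℕ) : Function.Injective (shiftRow m n) := by
  intro i j h
  unfold shiftRow at h
  split_ifs at h <;> omega

theorem exists_shiftRow_eq (m n : ℕ) {i : ℕ} (hi : i ≠ 0) : ∃ j, shiftRow m n j = i := by
  unfold shiftRow
  by_cases h1 : i ≤ n
  · exact ⟨i - 1 + m, by split_ifs <;> omega⟩
  · by_cases h2 : i ≤ m + n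
    · exact ⟨i - n - 1, by split_ifs <;> omega⟩
    · exact ⟨i - 1, by split_ifs <;> omega⟩

theorem shiftRow_ne_zero (m n i : ℕ) : shiftRow m n i ≠ 0 := by
  unfold shiftRow
  split_ifs <;> omega

theorem shiftRow_lt_iff (m n i : ℕ) : shiftRow m n i < m + n + 1 ↔ i < m + n := by
  unfold shiftRow
  split_ifs <;> omega

/-- The set of rows of `r ++ w` corresponding to a set of rows of `raised r w`. -/
noncomputable def lowerDec (m n : ℕ) (S : Finset ℕ) : Finset ℕ :=
  S.preimage (shiftRow m n) (shiftRow_injective m n).injOn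

theorem mem_lowerDec {m n : ℕ} {S : Finset ℕ} {i : ℕ} :
    i ∈ lowerDec m n S ↔ shiftRow m n i ∈ S := by
  simp [lowerDec]

theorem exists_lowerDec_eq (m n : ℕ) (T : Finset ℕ) (P : Prop) [Decidable P] :
    ∃ S, lowerDec m n S = T ∧ (0 ∈ S ↔ P) := by
  refine ⟨T.image (shiftRow m n) ∪ if P then {0} else ∅, ?_, ?_⟩
  · ext i
    have h0 := shiftRow_ne_zero m n i
    rw [mem_lowerDec, Finset.mem_union, (shiftRow_injective m n).mem_finset_image]
    split_ifs <;> simp [h0]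
  · have h : 0 ∉ T.image (shiftRow m n) := by simp [shiftRow_ne_zero]
    rw [Finset.mem_union]
    split_ifs with hP <;> simp [h, hP]

theorem sum_eq_sum_lowerDec (m n : ℕ) (S : Finset ℕ) (f : ℕ → ℕ) :
    ∑ i ∈ S, f i = (if 0 ∈ S then f 0 else 0) + ∑ i ∈ lowerDec m n S, f (shiftRow m n i) := by
  have h : ∑ i ∈ lowerDec m n S, f (shiftRow m n i) = ∑ i ∈ S.erase 0, f i := by
    refine Finset.sum_bij (fun i _ => shiftRow m n i) ?_ ?_ ?_ ?_
    · intro i hi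
      exact Finset.mem_erase.2 ⟨shiftRow_ne_zero m n i, mem_lowerDec.1 hi⟩
    · intro i _ j _ hij
      exact shiftRow_injective m n hij
    · intro i hi
      obtain ⟨h0, hS⟩ := Finset.mem_erase.1 hi
      obtain ⟨j, rfl⟩ := exists_shiftRow_eq m n h0
      exact ⟨j, mem_lowerDec.2 hS, rfl⟩
    · intro i _
      rfl
  rw [h]
  split_ifs with h0
  · exact (Finset.add_sum_erase S f h0).symm
  · rw [Finset.erase_eq_of_notMem h0, zero_add]

theorem card_eq_card_lowerDec (m n : ℕ) (S : Finset ℕ) :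
    S.card = (if 0 ∈ S then 1 else 0) + (lowerDec m n S).card := by
  simpa using sum_eq_sum_lowerDec m n S (fun _ => 1)

theorem lowerDec_range (m n : ℕ) :
    lowerDec m n (Finset.range (m + n + 1)) = Finset.range (m + n) := by
  ext i
  rw [mem_lowerDec, Finset.mem_range, Finset.mem_range, shiftRow_lt_iff]

theorem length_raised (r w : List ℕ) : (raised r w).length = r.length + w.length + 1 := by
  simp [raised]
  omega

theorem ent_append_left {r : List ℕ} (w : List ℕ) {i : ℕ} (h : i < r.length) :
    ent (r ++ w) i = ent r i :=
  List.getD_append _ _ _ _ h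

theorem ent_append_right (r w : List ℕ) {i : ℕ} (h : r.length ≤ i) :
    ent (r ++ w) i = ent w (i - r.length) :=
  List.getD_append_right _ _ _ _ h

theorem ent_raised_zero (r w : List ℕ) : ent (raised r w) 0 = 0 := rfl

theorem ent_raised_left (r : List ℕ) {w : List ℕ} {i : ℕ} (h : i < w.length) :
    ent (raised r w) (i + 1) = ent w i + 1 := by
  simp [ent, raised, List.getD_eq_getElem?_getD, List.getElem?_append, h]

theorem ent_raised_right (r w : List ℕ) (i : ℕ) :
    ent (raised r w) (i + w.length + 1) = ent r i := by
  simp [ent, raised, List.getD_eq_getElem?_getD, List.getElem?_append]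

theorem ent_raised_shiftRow (r w : List ℕ) {i : ℕ} (hi : i < r.length + w.length) :
    ent (raised r w) (shiftRow r.length w.length i) =
      ent (r ++ w) i + if i < r.length then 0 else 1 := by
  unfold shiftRow
  split_ifs with h
  · rw [ent_raised_right, ent_append_left w h, add_zero]
  · rw [ent_raised_left r (by omega), ent_append_right r w (by omega)]

theorem ent_of_length_le {l : List ℕ} {i : ℕ} (h : l.length ≤ i) : ent l i = 0 :=
  List.getD_eq_default _ _ h

theorem isRise_raised_shiftRow {r w : List ℕ} (hr : ent r 0 = 0) (hw : ent w 0 = 0) (i : ℕ) :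
    IsRise (raised r w) (shiftRow r.length w.length i) ↔ IsRise (r ++ w) i := by
  unfold IsRise
  rw [length_raised, List.length_append]
  by_cases h1 : i < r.length
  · have e : shiftRow r.length w.length i = i + w.length + 1 := if_pos h1
    rw [e, ent_raised_right, show i + w.length + 1 + 1 = (i + 1) + w.length + 1 by ring,
      ent_raised_right, ent_append_left w h1]
    by_cases h2 : i + 1 < r.length
    · rw [ent_append_left w h2]
      omega
    · rw [ent_append_right r w (by omega), show i + 1 - r.length = 0 by omega, hw]
      omega
  · by_cases h2 : i < r.length + w.length
    · have e : shiftRow r.length w.length i = i - r.length + 1 := by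
        simp [shiftRow, h1, h2]
      have e0 := ent_raised_left r (w := w) (i := i - r.length) (by omega)
      have e1 := ent_append_right r w (i := i) (by omega)
      have e2 := ent_append_right r w (i := i + 1) (by omega)
      rw [show i + 1 - r.length = i - r.length + 1 by omega] at e2
      rw [e, e0, e1, e2]
      by_cases h3 : i + 1 < r.length + w.length
      · rw [ent_raised_left r (by omega)]
        omega
      · have := ent_raised_right r w 0
        rw [hr] at this
        rw [show 0 + w.length + 1 = i - r.length + 1 + 1 by omega] at this
        rw [this]
        omega
    · have e : shiftRow r.length w.length i = i + 1 := by
        simp [shiftRow, h1, h2]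
      rw [e]
      omega

theorem isRise_raised_zero (r : List ℕ) {w : List ℕ} (hw : ent w 0 = 0) (hne : w ≠ []) :
    IsRise (raised r w) 0 := by
  have h : 0 < w.length := List.length_pos_of_ne_nil hne
  refine ⟨by rw [length_raised]; omega, ?_⟩
  rw [ent_raised_left r h, hw, ent_raised_zero]

theorem lowerDec_riseSet {r w : List ℕ} (hr : ent r 0 = 0) (hw : ent w 0 = 0) (S : Finset ℕ) :
    lowerDec r.length w.length (riseSet (raised r w) S) =
      riseSet (r ++ w) (lowerDec r.length w.length S) := by
  ext i
  simp [mem_lowerDec, riseSet, isRise_raised_shiftRow hr hw]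

theorem lowerDec_peakSet {r w : List ℕ} (hr : ent r 0 = 0) (hw : ent w 0 = 0) (S : Finset ℕ) :
    lowerDec r.length w.length (peakSet (raised r w) S) =
      peakSet (r ++ w) (lowerDec r.length w.length S) := by
  ext i
  simp only [mem_lowerDec, peakSet, IsPeak, isRise_raised_shiftRow hr hw, length_raised,
    shiftRow_lt_iff, Finset.mem_filter, List.length_append]

theorem zero_notMem_peakSet_raised (r : List ℕ) {w : List ℕ} (hw : ent w 0 = 0) (hne : w ≠ [])
    (S : Finset ℕ) : 0 ∉ peakSet (raised r w) S :=
  fun h => (Finset.mem_filter.1 h).2.2 (isRise_raised_zero r hw hne)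

theorem zero_mem_riseSet_raised (r : List ℕ) {w : List ℕ} (hw : ent w 0 = 0) (hne : w ≠ [])
    (S : Finset ℕ) : 0 ∈ riseSet (raised r w) S ↔ 0 ∈ S := by
  simp [riseSet, isRise_raised_zero r hw hne]

theorem card_peakSet_raised {r w : List ℕ} (hr : ent r 0 = 0) (hw : ent w 0 = 0) (hne : w ≠ [])
    (S : Finset ℕ) :
    (peakSet (raised r w) S).card = (peakSet (r ++ w) (lowerDec r.length w.length S)).card := by
  rw [card_eq_card_lowerDec r.length w.length, lowerDec_peakSet hr hw,
    if_neg (zero_notMem_peakSet_raised r hw hne S), zero_add]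

theorem card_riseSet_raised {r w : List ℕ} (hr : ent r 0 = 0) (hw : ent w 0 = 0) (hne : w ≠ [])
    (S : Finset ℕ) :
    (riseSet (raised r w) S).card =
      (if 0 ∈ S then 1 else 0) + (riseSet (r ++ w) (lowerDec r.length w.length S)).card := by
  rw [card_eq_card_lowerDec r.length w.length, lowerDec_riseSet hr hw]
  simp only [zero_mem_riseSet_raised r hw hne S]

/-! ### The statistic `dinv_∘` -/

theorem bval_eq_sum (l : List ℕ) (k : ℕ) :
    bval l k = ∑ j ∈ Finset.range l.length,
      ((if k < j ∧ ent l j = ent l k then 1 else 0) +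
        (if j < k ∧ ent l j = ent l k + 1 then 1 else 0)) := by
  rw [bval, Finset.card_filter, Finset.card_filter, Finset.sum_add_distrib]

theorem dinv_eq_sum_bval (l : List ℕ) : dinv l = ∑ k ∈ Finset.range l.length, bval l k := by
  have h : dinv l = ∑ i ∈ Finset.range l.length, ∑ j ∈ Finset.range l.length,
      ((if i < j ∧ ent l j = ent l i then 1 else 0) +
        (if i < j ∧ ent l i = ent l j + 1 then 1 else 0)) := by
    rw [dinv, dinvPairs, Finset.card_filter, Finset.sum_product]
    refine Finset.sum_congr rfl fun i _ => Finset.sum_congr rfl fun j _ => ?_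
    dsimp only
    split_ifs <;> omega
  rw [h]
  simp only [bval_eq_sum, Finset.sum_add_distrib]
  congr 1
  exact Finset.sum_comm

theorem bval_raised_shiftRow (r w : List ℕ) {i : ℕ} (hi : i < r.length + w.length) :
    bval (raised r w) (shiftRow r.length w.length i) = bval (r ++ w) i := by
  rw [bval_eq_sum, bval_eq_sum, length_raised, List.length_append,
    sum_eq_sum_lowerDec r.length w.length, lowerDec_range, ent_raised_zero]
  rw [if_pos (by simp), if_neg (by simp), if_neg (by omega), zero_add, zero_add]
  refine Finset.sum_congr rfl fun j hj => ?_
  have hj := Finset.mem_range.1 hj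
  rw [ent_raised_shiftRow r w hi, ent_raised_shiftRow r w hj]
  generalize ent (r ++ w) i = x
  generalize ent (r ++ w) j = y
  unfold shiftRow
  split_ifs <;> omega

theorem length_segStarts (l : List ℕ) : (segStarts l).length = l.count 0 := by
  have h : l = (List.range l.length).map (ent l) := by
    refine List.ext_getElem (by simp) fun i h1 h2 => ?_
    simp [ent, h1]
  conv_rhs => rw [h]
  rw [segStarts, ← List.countP_eq_length_filter, List.count, List.countP_map]
  rfl

theorem card_filter_ent_eq_zero (l : List ℕ) :
    ((Finset.range l.length).filter (fun i => ent l i = 0)).card = l.count 0 := by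
  rw [← length_segStarts, segStarts, ← List.toFinset_card_of_nodup (List.nodup_range.filter _)]
  congr 1
  ext i
  simp

theorem bval_raised_zero (r w : List ℕ) : bval (raised r w) 0 = r.count 0 := by
  rw [bval_eq_sum, length_raised, sum_eq_sum_lowerDec r.length w.length, lowerDec_range,
    ← card_filter_ent_eq_zero, Finset.card_filter, Finset.sum_range_add]
  simp only [ent_raised_zero, lt_irrefl, not_lt_zero, false_and, if_false, add_zero, ite_self,
    zero_add]
  rw [Finset.sum_eq_zero (s := Finset.range w.length), add_zero]
  · refine Finset.sum_congr rfl fun i hi => ?_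
    have hi := Finset.mem_range.1 hi
    rw [ent_raised_shiftRow r w (by omega), if_pos hi, add_zero, ent_append_left w hi]
    simp [Nat.pos_of_ne_zero (shiftRow_ne_zero _ _ _)]
  · intro i hi
    have hi := Finset.mem_range.1 hi
    rw [ent_raised_shiftRow r w (by omega)]
    simp

theorem dinv_raised (r w : List ℕ) : dinv (raised r w) = r.count 0 + dinv (r ++ w) := by
  rw [dinv_eq_sum_bval, dinv_eq_sum_bval, length_raised, List.length_append,
    sum_eq_sum_lowerDec r.length w.length, lowerDec_range, bval_raised_zero, if_pos (by simp)]
  congr 1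
  exact Finset.sum_congr rfl fun i hi => bval_raised_shiftRow r w (Finset.mem_range.1 hi)

theorem sum_bval_peakSet_le (l : List ℕ) (S : Finset ℕ) :
    ∑ i ∈ peakSet l S, bval l i ≤ dinv l := by
  rw [dinv_eq_sum_bval]
  refine Finset.sum_le_sum_of_subset fun i hi => ?_
  exact Finset.mem_range.2 (Finset.mem_filter.1 hi).2.1

theorem dinvC_raised {r w : List ℕ} (hr : ent r 0 = 0) (hw : ent w 0 = 0) (hne : w ≠ [])
    (S : Finset ℕ) :
    dinvC (raised r w) S = r.count 0 + dinvC (r ++ w) (lowerDec r.length w.length S) := by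
  have h : ∑ i ∈ peakSet (raised r w) S, bval (raised r w) i =
      ∑ i ∈ peakSet (r ++ w) (lowerDec r.length w.length S), bval (r ++ w) i := by
    rw [sum_eq_sum_lowerDec r.length w.length, lowerDec_peakSet hr hw,
      if_neg (zero_notMem_peakSet_raised r hw hne S), zero_add]
    refine Finset.sum_congr rfl fun i hi => bval_raised_shiftRow r w ?_
    simpa using (Finset.mem_filter.1 hi).2.1
  rw [dinvC, dinvC, h, dinv_raised, Nat.add_sub_assoc (sum_bval_peakSet_le _ _)]

/-! ### The statistic `area_∘` -/

theorem sum_eq_sum_ent (l : List ℕ) : l.sum = ∑ i ∈ Finset.range l.length, ent l i := by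
  rw [← Fin.sum_univ_getElem, ← Fin.sum_univ_eq_sum_range]
  simp [ent]

theorem sum_ent_riseSet_le (l : List ℕ) (S : Finset ℕ) :
    ∑ i ∈ riseSet l S, ent l (i + 1) ≤ area l := by
  rw [area, sum_eq_sum_ent, ← Finset.sum_image (f := ent l) (g := (· + 1)) (by simp)]
  refine Finset.sum_le_sum_of_subset fun i hi => ?_
  obtain ⟨j, hj, rfl⟩ := Finset.mem_image.1 hi
  exact Finset.mem_range.2 (Finset.mem_filter.1 hj).2.1

theorem area_raised (r w : List ℕ) : area (raised r w) = w.length + area (r ++ w) := by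
  simp [area, raised, List.sum_map_add]
  omega

theorem areaC_raised {r w : List ℕ} (hr : ent r 0 = 0) (hw : ent w 0 = 0) (hne : w ≠ [])
    (S : Finset ℕ) :
    areaC (raised r w) S +
        ((riseSet (raised r w) S).filter (fun i => 0 ≤ i ∧ i < w.length + 1)).card =
      w.length + areaC (r ++ w) (lowerDec r.length w.length S) := by
  have h : ∑ i ∈ riseSet (raised r w) S, ent (raised r w) (i + 1) =
      ((riseSet (raised r w) S).filter (fun i => 0 ≤ i ∧ i < w.length + 1)).card +
      ∑ i ∈ riseSet (r ++ w) (lowerDec r.length w.length S), ent (r ++ w) (i + 1) := by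
    rw [Finset.card_filter, sum_eq_sum_lowerDec r.length w.length,
      sum_eq_sum_lowerDec r.length w.length _ (fun i => if 0 ≤ i ∧ i < w.length + 1 then 1 else 0),
      lowerDec_riseSet hr hw, add_assoc, ← Finset.sum_add_distrib]
    congr 1
    · simp only [zero_mem_riseSet_raised r hw hne]
      have := (isRise_raised_zero r hw hne).2
      rw [this, ent_raised_zero]
      simp
    · refine Finset.sum_congr rfl fun i hi => ?_
      have hi2 := (Finset.mem_filter.1 hi).2
      have h1 := ((isRise_raised_shiftRow hr hw i).2 hi2).2
      obtain ⟨hlt, h2⟩ := hi2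
      rw [List.length_append] at hlt
      rw [h1, h2, ent_raised_shiftRow r w (by omega)]
      generalize ent (r ++ w) i = x
      unfold shiftRow
      split_ifs <;> omega
  have h1 := sum_ent_riseSet_le (raised r w) S
  have h2 := sum_ent_riseSet_le (r ++ w) (lowerDec r.length w.length S)
  have h3 := area_raised r w
  unfold areaC
  omega

/-! ### The last row of maximal height -/

/-- `m` is the last row of `l` attaining the maximal area value. -/
def IsLastMax (l : List ℕ) (m : ℕ) : Prop :=
  m < l.length ∧ ∀ j < l.length, ent l j ≤ ent l m ∧ (m < j → ent l j < ent l m)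

theorem lastMaxRow_eq_of_isLastMax {l : List ℕ} {m : ℕ} (h : IsLastMax l m) :
    lastMaxRow l = m := by
  apply le_antisymm
  · refine Finset.sup_le fun j hj => ?_
    obtain ⟨hj, hmax⟩ := Finset.mem_filter.1 hj
    have h1 := hmax m (Finset.mem_range.2 h.1)
    by_contra hlt
    have h2 := (h.2 j (Finset.mem_range.1 hj)).2 (not_le.1 hlt)
    omega
  · exact Finset.le_sup (f := id) (Finset.mem_filter.2 ⟨Finset.mem_range.2 h.1,
      fun j hj => (h.2 j (Finset.mem_range.1 hj)).1⟩)

theorem exists_isLastMax {l : List ℕ} (hl : l ≠ []) : ∃ m, IsLastMax l m := by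
  obtain ⟨m, hm, hmax⟩ := Finset.exists_max_image (Finset.range l.length)
    (fun i => toLex (ent l i, i))
    ⟨0, Finset.mem_range.2 (List.length_pos_of_ne_nil hl)⟩
  refine ⟨m, Finset.mem_range.1 hm, fun j hj => ?_⟩
  have := Prod.Lex.toLex_le_toLex.1 (hmax j (Finset.mem_range.2 hj))
  dsimp only at this
  omega

theorem isLastMax_raised {r w : List ℕ} {m : ℕ} (h : IsLastMax (r ++ w) m) :
    IsLastMax (raised r w) (shiftRow r.length w.length m) := by
  obtain ⟨hm, hmax⟩ := h
  rw [List.length_append] at hm hmax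
  refine ⟨by rw [length_raised, shiftRow_lt_iff]; exact hm, fun j hj => ?_⟩
  rw [length_raised] at hj
  rw [ent_raised_shiftRow r w hm]
  rcases eq_or_ne j 0 with rfl | hj0
  · exact ⟨by rw [ent_raised_zero]; omega, fun h => absurd h (by omega)⟩
  · obtain ⟨i, rfl⟩ := exists_shiftRow_eq r.length w.length hj0
    rw [shiftRow_lt_iff] at hj
    rw [ent_raised_shiftRow r w hj]
    have h1 := hmax i hj
    have h2 := hmax m hm
    generalize ent (r ++ w) i = x at *
    generalize ent (r ++ w) m = y at *
    unfold shiftRow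
    split_ifs <;> omega

theorem validDec_raised (r : List ℕ) {w : List ℕ} (hne : w ≠ []) (S : Finset ℕ) :
    ValidDec (raised r w) S ↔ ValidDec (r ++ w) (lowerDec r.length w.length S) := by
  obtain ⟨m, hm⟩ := exists_isLastMax (l := r ++ w) (by simp [hne])
  unfold ValidDec
  rw [lastMaxRow_eq_of_isLastMax hm, lastMaxRow_eq_of_isLastMax (isLastMax_raised hm),
    mem_lowerDec, length_raised, List.length_append]
  refine and_congr_left fun _ => ⟨fun h i hi => ?_, fun h i hi => ?_⟩
  · exact (shiftRow_lt_iff _ _ _).1 (h _ (mem_lowerDec.1 hi))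
  · rcases eq_or_ne i 0 with rfl | h0
    · omega
    · obtain ⟨j, rfl⟩ := exists_shiftRow_eq r.length w.length h0
      exact (shiftRow_lt_iff _ _ _).2 (h _ (mem_lowerDec.2 hi))

/-! ### Area sequences -/

theorem isDyck_iff_isChain (l : List ℕ) :
    IsDyck l ↔ l ≠ [] ∧ ent l 0 = 0 ∧ l.IsChain (fun x y => y ≤ x + 1) := by
  unfold IsDyck
  rw [List.isChain_iff_getElem]
  refine and_congr_right fun _ => and_congr_right fun _ => ⟨fun h i hi => ?_, fun h i h1 h2 => ?_⟩
  · simpa [ent, hi, Nat.lt_of_succ_lt hi] using h i (by omega) hi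
  · simpa [ent, h1, h2] using h i h2

theorem isDyck_raised {r w : List ℕ} (hr : ent r 0 = 0) (hw : ent w 0 = 0) (hne : w ≠ []) :
    IsDyck (raised r w) ↔ IsDyck (r ++ w) := by
  rw [isDyck_iff_isChain, isDyck_iff_isChain]
  obtain ⟨y, w', rfl⟩ := List.exists_cons_of_ne_nil hne
  obtain rfl : y = 0 := hw
  have h0 : ent (r ++ 0 :: w') 0 = 0 := by
    cases r with
    | nil => rfl
    | cons x r' => exact hr
  have hmap : ((0 :: w').map (· + 1)).IsChain (fun x y => y ≤ x + 1) ↔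
      (0 :: w').IsChain (fun x y => y ≤ x + 1) := by
    rw [List.isChain_map]
    simp
  have hhead : ∀ y ∈ r.head?, y = 0 := by
    cases r with
    | nil => simp
    | cons x r' => simpa [ent] using hr
  simp only [h0, ent_raised_zero]
  rw [raised, List.isChain_cons, List.isChain_append, List.isChain_append, hmap]
  constructor
  · rintro ⟨-, -, -, h1, h2, -⟩
    exact ⟨by simp, trivial, h2, h1, by simp⟩
  · rintro ⟨-, -, h2, h1, -⟩
    refine ⟨by simp, trivial, by simp, h1, h2, fun x _ y hy => ?_⟩
    rw [hhead y hy]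
    omega

theorem IsDyck.ent_le {l : List ℕ} (h : IsDyck l) (i : ℕ) : ent l i ≤ i := by
  induction i with
  | zero => exact h.2.1.le
  | succ i ih =>
    by_cases hi : i + 1 < l.length
    · exact (h.2.2 i (by omega) hi).trans (by omega)
    · rw [ent_of_length_le (not_lt.1 hi)]
      omega

theorem mem_decPaths {n : ℕ} {p : List ℕ × Finset ℕ} :
    p ∈ decPaths n ↔ p.1.length = n ∧ IsDyck p.1 ∧ ValidDec p.1 p.2 := by
  simp only [decPaths, Finset.mem_filter, Finset.mem_product, Finset.mem_powerset, allSeqs,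
    Finset.mem_image, Finset.mem_univ, true_and]
  constructor
  · rintro ⟨⟨⟨v, hv⟩, -⟩, h⟩
    exact ⟨by simp [← hv], h⟩
  · rintro ⟨rfl, h, hS⟩
    refine ⟨⟨⟨fun i => ⟨ent p.1 i, ?_⟩, ?_⟩, fun i hi => Finset.mem_range.2 (hS.1 i hi)⟩, h, hS⟩
    · have := h.ent_le i
      omega
    · refine List.ext_getElem (by simp) fun i h1 h2 => ?_
      simp [ent]

theorem exists_map_succ_append (l : List ℕ) :
    ∃ r w : List ℕ, l = w.map (· + 1) ++ r ∧ ent r 0 = 0 := by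
  induction l with
  | nil => exact ⟨[], [], rfl, rfl⟩
  | cons x l ih =>
    cases x with
    | zero => exact ⟨0 :: l, [], rfl, rfl⟩
    | succ x =>
      obtain ⟨r, w, rfl, hr⟩ := ih
      exact ⟨r, x :: w, rfl, hr⟩

theorem IsDyck.exists_eq_raised {l : List ℕ} (h : IsDyck l) :
    ∃ r w, l = raised r w ∧ ent r 0 = 0 ∧ ent w 0 = 0 := by
  obtain ⟨hne, h0, hstep⟩ := h
  obtain ⟨x, l', rfl⟩ := List.exists_cons_of_ne_nil hne
  obtain rfl : x = 0 := h0
  obtain ⟨r, w, rfl, hr⟩ := exists_map_succ_append l'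
  refine ⟨r, w, rfl, hr, ?_⟩
  cases w with
  | nil => rfl
  | cons y w =>
    have := hstep 0 (by simp) (by simp)
    simp only [ent, List.map_cons, List.cons_append, List.getD_cons_succ, List.getD_cons_zero]
      at this ⊢
    omega

theorem map_succ_append_inj {r r' w w' : List ℕ} (hr : ent r 0 = 0) (hr' : ent r' 0 = 0)
    (h : w.map (· + 1) ++ r = w'.map (· + 1) ++ r') : r = r' ∧ w = w' := by
  induction w generalizing w' with
  | nil =>
    cases w' with
    | nil => exact ⟨h, rfl⟩
    | cons x w' =>
      subst h
      exact absurd hr (Nat.succ_ne_zero x)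
  | cons x w ih =>
    cases w' with
    | nil =>
      obtain rfl : _ = r' := h
      exact absurd hr' (Nat.succ_ne_zero x)
    | cons x' w' =>
      obtain ⟨h1, h2⟩ := List.cons.inj h
      obtain ⟨rfl, rfl⟩ := ih h2
      exact ⟨rfl, by rw [Nat.succ.inj h1]⟩

theorem raised_inj {r r' w w' : List ℕ} (hr : ent r 0 = 0) (hr' : ent r' 0 = 0)
    (h : raised r w = raised r' w') : r = r' ∧ w = w' :=
  map_succ_append_inj hr hr' (List.cons.inj h).2

theorem exists_append_of_lt_count {l : List ℕ} {p : ℕ} (h : p < l.count 0) :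
    ∃ r w, l = r ++ 0 :: w ∧ r.count 0 = p := by
  induction l generalizing p with
  | nil => simp at h
  | cons x l ih =>
    rcases eq_or_ne x 0 with rfl | hx
    · cases p with
      | zero => exact ⟨[], l, rfl, rfl⟩
      | succ p =>
        obtain ⟨r, w, rfl, hr⟩ := ih (p := p) (by simpa using h)
        exact ⟨0 :: r, w, rfl, by simp [hr]⟩
    · obtain ⟨r, w, rfl, hr⟩ := ih (p := p) (by simpa [hx] using h)
      exact ⟨x :: r, w, rfl, by simp [hx, hr]⟩

theorem append_zero_cons_inj {r r' w w' : List ℕ} (h : r ++ 0 :: w = r' ++ 0 :: w')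
    (hc : r.count 0 = r'.count 0) : r = r' ∧ w = w' := by
  induction r generalizing r' with
  | nil =>
    cases r' with
    | nil => simpa using h
    | cons x r' =>
      obtain ⟨rfl, -⟩ := List.cons.inj h
      simp at hc
  | cons x r ih =>
    cases r' with
    | nil =>
      obtain ⟨rfl, -⟩ := List.cons.inj h
      simp at hc
    | cons y r' =>
      obtain ⟨rfl, h'⟩ := List.cons.inj h
      obtain ⟨rfl, rfl⟩ := ih h' (by simpa [List.count_cons] using hc)
      exact ⟨rfl, rfl⟩

/-! ### The rise-touch composition -/

/-- The list of the values of `f` at consecutive entries of `s ++ [n]`. -/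
def segParts (f : ℕ → ℕ → ℕ) (s : List ℕ) (n : ℕ) : List ℕ :=
  List.zipWith f s (s.drop 1 ++ [n])

/-- The length of the segment from row `c` to row `d`, diminished by the number of its rows
lying in `R`. -/
def partSize (R : Finset ℕ) (c d : ℕ) : ℕ :=
  (d - c) - (R.filter (fun i => c ≤ i ∧ i < d)).card

theorem riseTouch_eq_segParts (l : List ℕ) (S : Finset ℕ) :
    riseTouch l S = segParts (partSize (riseSet l S)) (segStarts l) l.length := rfl

theorem length_segParts (f : ℕ → ℕ → ℕ) (s : List ℕ) (n : ℕ) :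
    (segParts f s n).length = s.length := by
  simp only [segParts, List.length_zipWith, List.length_append, List.length_drop,
    List.length_singleton]
  omega

theorem segParts_cons_cons (f : ℕ → ℕ → ℕ) (c d : ℕ) (s : List ℕ) (n : ℕ) :
    segParts f (c :: d :: s) n = f c d :: segParts f (d :: s) n := rfl

theorem segParts_append_cons (f : ℕ → ℕ → ℕ) (s : List ℕ) (c : ℕ) (s' : List ℕ) (n : ℕ) :
    segParts f (s ++ c :: s') n = segParts f s c ++ segParts f (c :: s') n := by
  induction s with
  | nil => rfl
  | cons x s ih =>
    cases s with
    | nil => rfl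
    | cons y s =>
      rw [List.cons_append, List.cons_append, segParts_cons_cons, segParts_cons_cons,
        List.cons_append, ← ih, List.cons_append]

theorem segParts_map {f f' : ℕ → ℕ → ℕ} {g : ℕ → ℕ} {s : List ℕ} {n : ℕ}
    (hs : ∀ x ∈ s, x ≤ n) (h : ∀ c d, d ≤ n → f (g c) (g d) = f' c d) :
    segParts f (s.map g) (g n) = segParts f' s n := by
  induction s with
  | nil => rfl
  | cons x s ih =>
    cases s with
    | nil => exact congrArg (fun y => [y]) (h x n le_rfl)
    | cons y s =>
      rw [List.map_cons, List.map_cons, segParts_cons_cons, segParts_cons_cons, ← List.map_cons,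
        ih fun z hz => hs z (List.mem_cons_of_mem _ hz), h x y (hs y (by simp))]

theorem segStarts_append (x y : List ℕ) :
    segStarts (x ++ y) = segStarts x ++ (segStarts y).map (x.length + ·) := by
  rw [segStarts, List.length_append, List.range_add, List.filter_append, List.filter_map]
  congr 1
  · refine List.filter_congr fun i hi => ?_
    rw [ent_append_left y (List.mem_range.1 hi)]
  · rw [segStarts]
    congr 1
    refine List.filter_congr fun i _ => ?_
    simp [ent_append_right x y (Nat.le_add_right x.length i)]

theorem segStarts_eq_cons {l : List ℕ} (hl : l ≠ []) (h0 : ent l 0 = 0) :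
    ∃ s, segStarts l = 0 :: s := by
  obtain ⟨x, l, rfl⟩ := List.exists_cons_of_ne_nil hl
  rw [segStarts, List.length_cons, List.range_succ_eq_map, List.filter_cons_of_pos (by simp [h0])]
  exact ⟨_, rfl⟩

theorem segStarts_raised (r w : List ℕ) :
    segStarts (raised r w) = 0 :: (segStarts r).map (w.length + 1 + ·) := by
  have h : segStarts (0 :: w.map (· + 1)) = [0] := by
    obtain ⟨s, hs⟩ := segStarts_eq_cons (l := 0 :: w.map (· + 1)) (by simp) rfl
    have := length_segStarts (0 :: w.map (· + 1))
    rw [hs, List.count_cons_self, List.count_eq_zero.2 (by simp)] at this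
    rw [hs, List.eq_nil_of_length_eq_zero (Nat.succ.inj this)]
  rw [show raised r w = (0 :: w.map (· + 1)) ++ r from rfl, segStarts_append, h]
  simp

theorem mem_segStarts {l : List ℕ} {i : ℕ} : i ∈ segStarts l ↔ i < l.length ∧ ent l i = 0 := by
  simp [segStarts]

theorem partSize_add (m n : ℕ) (R : Finset ℕ) {c d : ℕ} (hd : d ≤ m) :
    partSize R (n + 1 + c) (n + 1 + d) = partSize (lowerDec m n R) c d := by
  have h : lowerDec m n (R.filter (fun i => n + 1 + c ≤ i ∧ i < n + 1 + d)) =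
      (lowerDec m n R).filter (fun i => c ≤ i ∧ i < d) := by
    ext i
    simp only [mem_lowerDec, Finset.mem_filter]
    refine and_congr_right fun _ => ?_
    unfold shiftRow
    split_ifs <;> omega
  rw [partSize, partSize, card_eq_card_lowerDec m n, h, if_neg (by simp)]
  omega

theorem riseTouch_raised {r w : List ℕ} (hr : ent r 0 = 0) (hw : ent w 0 = 0) (S : Finset ℕ) :
    riseTouch (raised r w) S = partSize (riseSet (raised r w) S) 0 (w.length + 1) ::
      segParts (partSize (riseSet (r ++ w) (lowerDec r.length w.length S)))
        (segStarts r) r.length := by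
  rw [← lowerDec_riseSet hr hw, riseTouch_eq_segParts, segStarts_raised, length_raised,
    show r.length + w.length + 1 = w.length + 1 + r.length by ring]
  generalize riseSet (raised r w) S = R
  have h := segParts_map (f := partSize R) (f' := partSize (lowerDec r.length w.length R))
    (g := (w.length + 1 + ·)) (s := segStarts r) (n := r.length)
    (fun x hx => (mem_segStarts.1 hx).1.le) (fun c d hd => partSize_add _ _ _ hd)
  rw [← h]
  rcases eq_or_ne r [] with rfl | hne
  · rfl
  · obtain ⟨s, hs⟩ := segStarts_eq_cons hne hr
    rw [hs]
    rfl

theorem riseTouch_append (r : List ℕ) {w : List ℕ} (hw : ent w 0 = 0) (hne : w ≠ [])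
    (T : Finset ℕ) :
    segParts (partSize (riseSet (r ++ w) T)) (segStarts r) r.length <+: riseTouch (r ++ w) T := by
  obtain ⟨s, hs⟩ := segStarts_eq_cons hne hw
  rw [riseTouch_eq_segParts, segStarts_append, hs, List.map_cons, segParts_append_cons]
  exact List.prefix_append _ _

theorem partSize_spec {R : Finset ℕ} {c d : ℕ} (hcd : c < d) (hd : d - 1 ∉ R) :
    0 < partSize R c d ∧
      partSize R c d + (R.filter (fun i => c ≤ i ∧ i < d)).card = d - c := by
  have h : (R.filter (fun i => c ≤ i ∧ i < d)).card ≤ (Finset.Ico c (d - 1)).card := by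
    refine Finset.card_le_card fun i hi => ?_
    obtain ⟨hR, h1, h2⟩ := Finset.mem_filter.1 hi
    have : i ≠ d - 1 := fun h => hd (h ▸ hR)
    rw [Finset.mem_Ico]
    omega
  rw [Nat.card_Ico] at h
  unfold partSize
  omega

theorem segParts_spec {R : Finset ℕ} {c n : ℕ} {s : List ℕ} (hs : (c :: s).Pairwise (· < ·))
    (hlt : ∀ x ∈ c :: s, x < n) (hR : ∀ x ∈ s, x - 1 ∉ R) (hn : n - 1 ∉ R) :
    (∀ y ∈ segParts (partSize R) (c :: s) n, 0 < y) ∧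
      (segParts (partSize R) (c :: s) n).sum + (R.filter (fun i => c ≤ i ∧ i < n)).card =
        n - c := by
  induction s generalizing c with
  | nil =>
    have := partSize_spec (hlt c (by simp)) hn
    simpa [segParts] using this
  | cons d s ih =>
    have hcd : c < d := (List.pairwise_cons.1 hs).1 d (by simp)
    have hdn : d < n := hlt d (by simp)
    obtain ⟨h1, h2⟩ := partSize_spec hcd (hR d (by simp))
    obtain ⟨h3, h4⟩ := ih (List.pairwise_cons.1 hs).2
      (fun x hx => hlt x (List.mem_cons_of_mem _ hx))
      (fun x hx => hR x (List.mem_cons_of_mem _ hx))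
    rw [segParts_cons_cons]
    refine ⟨List.forall_mem_cons.2 ⟨h1, h3⟩, ?_⟩
    have hsplit : (R.filter (fun i => c ≤ i ∧ i < n)).card =
        (R.filter (fun i => c ≤ i ∧ i < d)).card + (R.filter (fun i => d ≤ i ∧ i < n)).card := by
      simp only [Finset.card_filter, ← Finset.sum_add_distrib]
      refine Finset.sum_congr rfl fun i _ => ?_
      split_ifs <;> omega
    rw [List.sum_cons, hsplit]
    omega

theorem IsDyck.riseTouch_spec {l : List ℕ} (h : IsDyck l) (S : Finset ℕ) :
    (∀ y ∈ riseTouch l S, 0 < y) ∧ (riseTouch l S).sum + (riseSet l S).card = l.length := by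
  obtain ⟨hne, h0, -⟩ := h
  obtain ⟨s, hs⟩ := segStarts_eq_cons hne h0
  have hpos := List.length_pos_of_ne_nil hne
  have hsorted : (0 :: s).Pairwise (· < ·) := hs ▸ List.pairwise_lt_range.filter _
  have hmem : ∀ x ∈ 0 :: s, x < l.length ∧ ent l x = 0 := fun x hx => mem_segStarts.1 (hs ▸ hx)
  have key := segParts_spec (R := riseSet l S) (n := l.length) hsorted (fun x hx => (hmem x hx).1)
    (fun x hx hR => by
      have hx0 := (List.pairwise_cons.1 hsorted).1 x hx
      have := (Finset.mem_filter.1 hR).2.2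
      rw [Nat.sub_add_cancel hx0, (hmem x (List.mem_cons_of_mem _ hx)).2] at this
      omega)
    (fun hR => by
      have := (Finset.mem_filter.1 hR).2.1
      omega)
  rw [riseTouch_eq_segParts, hs]
  refine ⟨key.1, ?_⟩
  have hfilter : (riseSet l S).filter (fun i => 0 ≤ i ∧ i < l.length) = riseSet l S := by
    refine Finset.filter_true_of_mem fun i hi => ?_
    have := (Finset.mem_filter.1 hi).2.1
    omega
  have h2 := key.2
  rwa [hfilter, Nat.sub_zero] at h2

theorem IsDyck.exists_eq_raised_of_riseTouch_eq {l : List ℕ} (h : IsDyck l) {S : Finset ℕ}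
    {a : ℕ} (ha : 1 ≤ a) {β : List ℕ} (hS : riseTouch l S = (a + 1) :: β) :
    ∃ r w : List ℕ, l = raised r w ∧ ent r 0 = 0 ∧ ent w 0 = 0 ∧ w ≠ [] ∧
      r.count 0 = β.length := by
  obtain ⟨r, w, rfl, hr, hw⟩ := h.exists_eq_raised
  rw [riseTouch_raised hr hw] at hS
  obtain ⟨h1, h2⟩ := List.cons.inj hS
  refine ⟨r, w, rfl, hr, hw, ?_, by rw [← h2, length_segParts, length_segStarts]⟩
  rintro rfl
  simp only [partSize, List.length_nil] at h1
  omega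

theorem length_riseTouch (l : List ℕ) (S : Finset ℕ) : (riseTouch l S).length = l.count 0 := by
  rw [riseTouch_eq_segParts, length_segParts, length_segStarts]

/-! ### The recurrence -/

/-- The summand of `CatRise` attached to a decorated path. -/
def weight {A : Type*} [CommRing A] (q t : A) (p : List ℕ × Finset ℕ) : A :=
  q ^ dinvC p.1 p.2 * t ^ areaC p.1 p.2

theorem catRise_natCast {A : Type*} [CommRing A] (q t : A) (α : List ℕ) (K L : ℕ) :
    CatRise q t α K L = ∑ p ∈ (decPaths (α.sum + L)).filter
      (fun p => (peakSet p.1 p.2).card = K ∧ (riseSet p.1 p.2).card = L ∧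
        riseTouch p.1 p.2 = α), weight q t p := by
  simp [CatRise, weight]

theorem sum_composition_catRise {A : Type*} [CommRing A] (q t : A) (a : ℕ) (β : List ℕ)
    (K L : ℕ) :
    ∑ γ : Composition a, CatRise q t (β ++ γ.blocks) K L =
      ∑ p ∈ (decPaths (β.sum + a + L)).filter
        (fun p => (peakSet p.1 p.2).card = K ∧ (riseSet p.1 p.2).card = L ∧
          β <+: riseTouch p.1 p.2), weight q t p := by
  simp only [catRise_natCast, List.sum_append, Composition.blocks_sum]
  rw [← Finset.sum_biUnion]
  · refine Finset.sum_congr (Finset.ext fun p => ?_) fun _ _ => rfl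
    simp only [Finset.mem_biUnion, Finset.mem_univ, true_and, Finset.mem_filter]
    constructor
    · rintro ⟨γ, hp, h1, h2, h3⟩
      exact ⟨hp, h1, h2, h3 ▸ List.prefix_append _ _⟩
    · rintro ⟨hp, h1, h2, C, hC⟩
      obtain ⟨hlen, hD, -⟩ := mem_decPaths.1 hp
      obtain ⟨hpos, hsum⟩ := hD.riseTouch_spec p.2
      rw [← hC] at hpos hsum
      rw [List.sum_append] at hsum
      exact ⟨⟨C, fun hi => hpos _ (List.mem_append_right _ hi), by omega⟩, hp, h1, h2, hC.symm⟩
  · intro γ _ γ' _ hne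
    refine Finset.disjoint_left.2 fun p hp hp' => hne ?_
    have h := (Finset.mem_filter.1 hp).2.2.2
    have h' := (Finset.mem_filter.1 hp').2.2.2
    exact Composition.ext (List.append_cancel_left (h.symm.trans h'))

theorem weight_raised {A : Type*} [CommRing A] (q t : A) {a : ℕ} {β r w : List ℕ}
    (hr : ent r 0 = 0) (hw : ent w 0 = 0) (hne : w ≠ []) {S : Finset ℕ}
    (h : riseTouch (raised r w) S = (a + 1) :: β) :
    weight q t (raised r w, S) =
      t ^ a * q ^ β.length * weight q t (r ++ w, lowerDec r.length w.length S) := by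
  rw [riseTouch_raised hr hw] at h
  obtain ⟨h1, h2⟩ := List.cons.inj h
  have hlen : r.count 0 = β.length := by rw [← h2, length_segParts, length_segStarts]
  have harea := areaC_raised hr hw hne S
  have ha : areaC (raised r w) S = a + areaC (r ++ w) (lowerDec r.length w.length S) := by
    unfold partSize at h1
    omega
  rw [weight, weight, ha, dinvC_raised hr hw hne, hlen]
  ring

/-- The paths counted by `CatRise q t ((a + 1) :: β) K (L + e)` whose first row is decorated
(`e = 1`) or not (`e = 0`) correspond to paths with one row and `e` decorations less. -/
theorem sum_weight_first_row {A : Type*} [CommRing A] (q t : A) {a : ℕ} (ha : 1 ≤ a)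
    (β : List ℕ) (K L e N : ℕ) (P : Prop) [Decidable P] (he : e = if P then 1 else 0)
    (hN : N = β.sum + (a + e) + L) :
    ∑ p ∈ (decPaths (N + 1)).filter
        (fun p => ((peakSet p.1 p.2).card = K ∧ (riseSet p.1 p.2).card = L + e ∧
          riseTouch p.1 p.2 = (a + 1) :: β) ∧ (0 ∈ p.2 ↔ P)), weight q t p =
      t ^ a * q ^ β.length * ∑ p ∈ (decPaths N).filter
        (fun p => (peakSet p.1 p.2).card = K ∧ (riseSet p.1 p.2).card = L ∧
          β <+: riseTouch p.1 p.2), weight q t p := by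
  rw [Finset.mul_sum]
  have hex : ∀ p ∈ (decPaths (N + 1)).filter
      (fun p => ((peakSet p.1 p.2).card = K ∧ (riseSet p.1 p.2).card = L + e ∧
        riseTouch p.1 p.2 = (a + 1) :: β) ∧ (0 ∈ p.2 ↔ P)),
      ∃ r w : List ℕ, p.1 = raised r w ∧ ent r 0 = 0 ∧ ent w 0 = 0 ∧ w ≠ [] ∧
        r.count 0 = β.length := by
    intro p hp
    obtain ⟨hp, ⟨-, -, h3⟩, -⟩ := Finset.mem_filter.1 hp
    exact (mem_decPaths.1 hp).2.1.exists_eq_raised_of_riseTouch_eq ha h3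
  choose! r w hl hr hw hne hc using hex
  refine Finset.sum_bij
    (fun p _ => (r p ++ w p, lowerDec (r p).length (w p).length p.2)) ?_ ?_ ?_ ?_
  · intro p hp
    have hl := hl p hp
    have hr := hr p hp
    have hw := hw p hp
    have hne := hne p hp
    obtain ⟨hp, ⟨h1, h2, h3⟩, h4⟩ := Finset.mem_filter.1 hp
    obtain ⟨hlen, hD, hV⟩ := mem_decPaths.1 hp
    rw [hl] at h1 h2 h3 hlen hD hV
    rw [card_peakSet_raised hr hw hne] at h1
    rw [card_riseSet_raised hr hw hne, if_congr h4 rfl rfl, ← he] at h2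
    rw [riseTouch_raised hr hw] at h3
    rw [length_raised] at hlen
    refine Finset.mem_filter.2 ⟨mem_decPaths.2 ⟨by simp; omega, (isDyck_raised hr hw hne).1 hD,
      (validDec_raised _ hne _).1 hV⟩, h1, by dsimp only; omega, ?_⟩
    rw [← (List.cons.inj h3).2]
    exact riseTouch_append _ hw hne _
  · intro p hp p' hp' heq
    have key := (Finset.mem_filter.1 hp).2.2.trans (Finset.mem_filter.1 hp').2.2.symm
    obtain ⟨h1, h2⟩ := Prod.mk.inj heq
    obtain ⟨x, v, hv⟩ := List.exists_cons_of_ne_nil (hne p hp)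
    obtain ⟨x', v', hv'⟩ := List.exists_cons_of_ne_nil (hne p' hp')
    obtain rfl : x = 0 := by have := hw p hp; rwa [hv] at this
    obtain rfl : x' = 0 := by have := hw p' hp'; rwa [hv'] at this
    rw [hv, hv'] at h1
    obtain ⟨hrr, hvv⟩ := append_zero_cons_inj h1 ((hc p hp).trans (hc p' hp').symm)
    have hww : w p = w p' := by rw [hv, hv', hvv]
    refine Prod.ext (by rw [hl p hp, hl p' hp', hrr, hww]) (Finset.ext fun i => ?_)
    rw [hrr, hww] at h2
    rcases eq_or_ne i 0 with rfl | h0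
    · exact key
    · obtain ⟨j, rfl⟩ := exists_shiftRow_eq (r p').length (w p').length h0
      rw [← mem_lowerDec, ← mem_lowerDec, h2]
  · rintro ⟨l, T⟩ hp
    obtain ⟨hp, h1, h2, h3⟩ := Finset.mem_filter.1 hp
    obtain ⟨hlen, hD, hV⟩ := mem_decPaths.1 hp
    dsimp only at h1 h2 h3 hlen hD hV
    have hcount : β.length < l.count 0 := by
      obtain ⟨C, hC⟩ := h3
      have hsum := (hD.riseTouch_spec T).2
      rw [← length_riseTouch l T, ← hC, List.length_append]
      rw [← hC, List.sum_append] at hsum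
      have : C ≠ [] := by
        rintro rfl
        simp only [List.sum_nil] at hsum
        omega
      have := List.length_pos_of_ne_nil this
      omega
    obtain ⟨x, v, rfl, hx⟩ := exists_append_of_lt_count hcount
    have hx0 : ent x 0 = 0 := by
      cases x with
      | nil => rfl
      | cons y x => exact hD.2.1
    have hv0 : ent (0 :: v) 0 = 0 := rfl
    have hvne : 0 :: v ≠ [] := List.cons_ne_nil _ _
    generalize 0 :: v = y at *
    obtain ⟨S, hS, hS0⟩ := exists_lowerDec_eq x.length y.length T P
    have hmem : (raised x y, S) ∈ (decPaths (N + 1)).filter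
        (fun p => ((peakSet p.1 p.2).card = K ∧ (riseSet p.1 p.2).card = L + e ∧
          riseTouch p.1 p.2 = (a + 1) :: β) ∧ (0 ∈ p.2 ↔ P)) := by
      have hD' := (isDyck_raised hx0 hv0 hvne).2 hD
      have hlen' : (raised x y).length = N + 1 := by
        rw [length_raised, ← List.length_append, hlen]
      have hrise : (riseSet (raised x y) S).card = L + e := by
        rw [card_riseSet_raised hx0 hv0 hvne, hS, h2, if_congr hS0 rfl rfl, ← he, add_comm]
      refine Finset.mem_filter.2 ⟨mem_decPaths.2 ⟨hlen', hD',
        (validDec_raised _ hvne _).2 (by rw [hS]; exact hV)⟩,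
        ⟨by rw [← h1, ← hS]; exact card_peakSet_raised hx0 hv0 hvne S, hrise, ?_⟩, hS0⟩
      have hsum := (hD'.riseTouch_spec S).2
      have hβ : segParts (partSize (riseSet (x ++ y) T)) (segStarts x) x.length = β := by
        have hle : (segParts (partSize (riseSet (x ++ y) T)) (segStarts x) x.length).length =
            β.length := by rw [length_segParts, length_segStarts, hx]
        exact (List.prefix_of_prefix_length_le (riseTouch_append x hv0 hvne T) h3
          hle.le).eq_of_length hle
      dsimp only
      rw [riseTouch_raised hx0 hv0, hS, hβ] at hsum ⊢
      rw [List.sum_cons] at hsum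
      congr 1
      omega
    obtain ⟨hxr, hyw⟩ := raised_inj hx0 (hr _ hmem) (hl _ hmem)
    exact ⟨_, hmem, by rw [← hxr, ← hyw, hS]⟩
  · intro p hp
    have h3 := (Finset.mem_filter.1 hp).2.1.2.2
    have hpe : p = (raised (r p) (w p), p.2) := Prod.ext (hl p hp) rfl
    rw [hl p hp] at h3
    conv_lhs => rw [hpe]
    exact weight_raised q t (hr p hp) (hw p hp) (hne p hp) h3

end DeltaCat

/-- Proposition 3.1 (case `a ≥ 1` of the combinatorial recurrence): for integers
`a ≥ 1`, `k, ℓ ≥ 0` and any composition `β`,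
`Cat^Rise_{(a+1,β),k,ℓ} = t^a q^{ℓ(β)} Σ_{γ ⊨ a} Cat^Rise_{(β,γ),k,ℓ}
 + t^a q^{ℓ(β)} Σ_{γ ⊨ a+1} Cat^Rise_{(β,γ),k,ℓ-1}`. -/
theorem catRise_rec_of_one_le (a : ℕ) (ha : 1 ≤ a) (k ℓ : ℤ) (hk : 0 ≤ k) (hℓ : 0 ≤ ℓ)
    (β : List ℕ) (hβ : ∀ x ∈ β, 0 < x) :
    CatRise q t ((a + 1) :: β) k ℓ =
      t ^ a * q ^ β.length * ∑ γ : Composition a, CatRise q t (β ++ γ.blocks) k ℓ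
        + t ^ a * q ^ β.length *
            ∑ γ : Composition (a + 1), CatRise q t (β ++ γ.blocks) k (ℓ - 1) := by
  lift k to ℕ using hk
  lift ℓ to ℕ using hℓ
  rw [catRise_natCast, ← Finset.sum_filter_add_sum_filter_not _ (fun p => 0 ∉ p.2),
    Finset.filter_filter, Finset.filter_filter, sum_composition_catRise]
  congr 1
  · rw [← sum_weight_first_row q t ha β k ℓ 0 (β.sum + a + ℓ) False (by simp) rfl]
    simp only [List.sum_cons, iff_false, add_zero]
    rw [show a + 1 + β.sum + ℓ = β.sum + a + ℓ + 1 by ring]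
  · cases ℓ with
    | zero =>
      rw [Finset.sum_eq_zero, Finset.sum_eq_zero, mul_zero]
      · intro γ _
        simp [CatRise]
      · intro p hp
        obtain ⟨hp, ⟨-, h2, h3⟩, h0⟩ := Finset.mem_filter.1 hp
        obtain ⟨r, w, hl, -, hw, hne, -⟩ :=
          (mem_decPaths.1 hp).2.1.exists_eq_raised_of_riseTouch_eq ha h3
        rw [Finset.card_eq_zero, hl] at h2
        have := (zero_mem_riseSet_raised r hw hne p.2).2 (not_not.1 h0)
        simp [h2] at this
    | succ L =>
      rw [show ((L + 1 : ℕ) : ℤ) - 1 = (L : ℕ) by push_cast; ring, sum_composition_catRise,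
        ← sum_weight_first_row q t ha β k L 1 _ True (by simp) rfl]
      simp only [List.sum_cons, iff_true, not_not]
      rw [show a + 1 + β.sum + (L + 1) = β.sum + (a + 1) + L + 1 by ring]
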